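/- For all d ∈ ℕ and all Δ > 0 such that 10(d+1)²·Δ²·e^(2dΔ) ≤ 1, for any real polynomial g of degree at most d, ∫₀^∞ g(x)²·x·e^(-x) dx ≥ 10·Δ²·g(-Δ)². -/

import Mathlib

open Polynomial MeasureTheory Finset in
theorem integrableOn_eval_mul_exp_neg (p : ℝ[X]) :
    IntegrableOn (fun x => p.eval x * (x * Real.exp (-x))) (Set.Ioi 0) := by
  induction p using Polynomial.induction_on' with
  | add p q hp hq =>
    simp only [eval_add, add_mul]
    exact hp.add hq
  | monomial n a =>
    have h : IntegrableOn (fun x : ℝ => _) (Set.Ioi 0) volume :=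
      (Real.GammaIntegral_convergent (s := (n : ℝ) + 2) (by positivity)).const_mul a
    refine h.congr_fun (fun x _ => ?_) measurableSet_Ioi
    have hs : (n : ℝ) + 2 - 1 = ((n + 1 : ℕ) : ℝ) := by push_cast; ring
    simp only [eval_monomial, hs, Real.rpow_natCast]
    ring

open Polynomial MeasureTheory in
/-- Integration of polynomials against the weight `x * exp (-x)` on `(0, ∞)`. -/
noncomputable def laguerreIntegral : ℝ[X] →ₗ[ℝ] ℝ where
  toFun p := ∫ x in Set.Ioi (0 : ℝ), p.eval x * (x * Real.exp (-x))
  map_add' p q := by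
    simp only [eval_add, add_mul]
    exact integral_add (integrableOn_eval_mul_exp_neg p) (integrableOn_eval_mul_exp_neg q)
  map_smul' a p := by
    simp only [eval_smul, smul_eq_mul, mul_assoc, integral_const_mul, RingHom.id_apply]

open Polynomial MeasureTheory in
theorem laguerreIntegral_monomial (n : ℕ) (a : ℝ) :
    laguerreIntegral (monomial n a) = a * (n + 1).factorial := by
  have hs : (n : ℝ) + 2 - 1 = ((n + 1 : ℕ) : ℝ) := by push_cast; ring
  have h := Real.Gamma_eq_integral (s := (n : ℝ) + 2) (by positivity)
  have hG : Real.Gamma ((n : ℝ) + 2) = (n + 1).factorial := by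
    rw [← Real.Gamma_nat_eq_factorial]; push_cast; congr 1; ring
  rw [← hG, h, ← integral_const_mul]
  refine setIntegral_congr_fun measurableSet_Ioi (fun x _ => ?_)
  simp only [eval_monomial, hs, Real.rpow_natCast]
  ring

open Polynomial MeasureTheory in
theorem laguerreIntegral_sq_nonneg (p : ℝ[X]) : 0 ≤ laguerreIntegral (p * p) := by
  refine setIntegral_nonneg measurableSet_Ioi (fun x hx => ?_)
  have : 0 < x := hx
  rw [eval_mul]
  have := mul_self_nonneg (p.eval x)
  positivity

open Polynomial in
/-- The generalized Laguerre polynomial with parameter `1`, with the sign chosen so that the leading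
coefficient is positive. -/
noncomputable def laguerreOne (k : ℕ) : ℝ[X] :=
  ∑ j ∈ Finset.range (k + 1), monomial j ((-1) ^ (k - j) * (k + 1).choose (j + 1) / j.factorial)

open Polynomial in
theorem laguerreOne_coeff_self (k : ℕ) : (laguerreOne k).coeff k = 1 / k.factorial := by
  simp [laguerreOne, finsetSum_coeff, coeff_monomial]

open Polynomial in
theorem laguerreOne_coeff_of_lt {k n : ℕ} (h : k < n) : (laguerreOne k).coeff n = 0 := by
  rw [laguerreOne, finsetSum_coeff]
  refine Finset.sum_eq_zero fun j hj => coeff_monomial_of_ne _ ?_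
  have := Finset.mem_range.mp hj
  omega

open Polynomial in
theorem ascPochhammer_eval_succ_eq_div (j m : ℕ) :
    (ascPochhammer ℝ m).eval ((j : ℝ) + 1) = ((j + m).factorial : ℝ) / j.factorial := by
  rw [eq_div_iff (by positivity), ← Nat.factorial_mul_ascFactorial,
    ← ascPochhammer_nat_eq_ascFactorial, Nat.cast_mul, ascPochhammer_eval_cast]
  push_cast
  ring

open Polynomial in
theorem laguerreIntegral_laguerreOne_mul_X_pow (k m : ℕ) :
    laguerreIntegral (laguerreOne k * X ^ m) =
      (fwdDiff 1)^[k + 1] (ascPochhammer ℝ (m + 1)).eval 0 := by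
  rw [fwdDiff_iter_eq_sum_shift, Finset.sum_range_succ', laguerreOne, Finset.sum_mul, map_sum]
  have h0 : (ascPochhammer ℝ (m + 1)).eval 0 = 0 := by simp
  simp only [zero_nsmul, add_zero, h0, smul_zero]
  refine Finset.sum_congr rfl fun j _ => ?_
  have hj : (0 : ℝ) + (j + 1) • (1 : ℝ) = j + 1 := by simp
  rw [monomial_mul_X_pow, laguerreIntegral_monomial, hj, ascPochhammer_eval_succ_eq_div,
    zsmul_eq_mul, Nat.add_sub_add_right, add_assoc]
  push_cast
  ring

open Polynomial in
theorem laguerreIntegral_laguerreOne_mul_eq_zero {k : ℕ} {q : ℝ[X]} (hq : q.degree < k) :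
    laguerreIntegral (laguerreOne k * q) = 0 := by
  rw [degree_lt_iff_coeff_zero] at hq
  rw [q.as_sum_support_C_mul_X_pow, Finset.mul_sum, map_sum]
  refine Finset.sum_eq_zero fun m hm => ?_
  have hmk : m < k := by
    by_contra! h
    exact mem_support_iff.mp hm (hq m h)
  rw [mul_left_comm, ← smul_eq_C_mul, map_smul, laguerreIntegral_laguerreOne_mul_X_pow,
    Polynomial.fwdDiff_iter_eq_zero_of_degree_lt (by rw [ascPochhammer_natDegree]; omega)]
  simp

open Polynomial in
theorem laguerreIntegral_laguerreOne_mul_self (k : ℕ) :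
    laguerreIntegral (laguerreOne k * laguerreOne k) = k + 1 := by
  have hlow : (laguerreOne k - C (1 / (k.factorial : ℝ)) * X ^ k).degree < (k : WithBot ℕ) := by
    rw [degree_lt_iff_coeff_zero]
    intro m hm
    rcases hm.eq_or_lt with rfl | hm
    · simp [laguerreOne_coeff_self]
    · simp [laguerreOne_coeff_of_lt hm, coeff_X_pow, hm.ne']
  have hX := laguerreIntegral_laguerreOne_mul_X_pow k k
  have hd := Polynomial.fwdDiff_iter_degree_eq_factorial (ascPochhammer ℝ (k + 1))
  rw [ascPochhammer_natDegree, (monic_ascPochhammer ℝ (k + 1)).leadingCoeff] at hd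
  rw [hd] at hX
  have h := laguerreIntegral_laguerreOne_mul_eq_zero hlow
  rw [mul_sub, map_sub, mul_left_comm, ← smul_eq_C_mul, map_smul, hX, sub_eq_zero] at h
  rw [h]
  simp [Nat.factorial_succ]
  field_simp

/-- One step of the Cauchy–Schwarz inequality. -/
theorem add_sq_le_of_sq_le_mul {a b c n A S : ℝ} (hn : 0 < n) (hA : 0 ≤ A) (hS : 0 ≤ S)
    (h : a ^ 2 ≤ A * S) : (a + c * b) ^ 2 ≤ (A + c ^ 2 * n) * (S + b ^ 2 / n) := by
  have hn' : b ^ 2 / n * n = b ^ 2 := by field_simp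
  have hu : 0 ≤ b ^ 2 / n := by positivity
  set u := b ^ 2 / n
  have hcross : 2 * (a * c * b) ≤ A * u + c ^ 2 * n * S := by
    refine le_of_abs_le (abs_le_of_sq_le_sq ?_ (by positivity))
    have h1 : (a * c * b) ^ 2 ≤ (A * u) * (c ^ 2 * n * S) := by
      calc (a * c * b) ^ 2 = a ^ 2 * (c ^ 2 * b ^ 2) := by ring
        _ ≤ A * S * (c ^ 2 * b ^ 2) := by gcongr
        _ = _ := by rw [← hn']; ring
    nlinarith [sq_nonneg (A * u - c ^ 2 * n * S)]
  have : c ^ 2 * n * u = c ^ 2 * b ^ 2 := by rw [← hn']; ring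
  nlinarith

open Polynomial in
theorem eval_sq_le_laguerreIntegral_mul_sum (n : ℕ) (y : ℝ) (g : ℝ[X]) (hg : g.degree < n) :
    g.eval y ^ 2 ≤ laguerreIntegral (g * g) *
      ∑ k ∈ Finset.range n, (laguerreOne k).eval y ^ 2 / (k + 1) := by
  induction n generalizing g with
  | zero =>
    have : g = 0 := by ext m; exact (degree_lt_iff_coeff_zero g 0).mp hg m (Nat.zero_le m)
    simp [this]
  | succ n ih =>
    rw [degree_lt_iff_coeff_zero] at hg
    set c := g.coeff n * n.factorial with hc
    obtain ⟨h, hh⟩ : ∃ h, h = g - c • laguerreOne n := ⟨_, rfl⟩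
    have hdeg : h.degree < n := by
      rw [degree_lt_iff_coeff_zero, hh]
      intro m hm
      rcases hm.eq_or_lt with rfl | hm
      · simp only [coeff_sub, coeff_smul, smul_eq_mul, laguerreOne_coeff_self, hc]
        field_simp
        ring
      · simp [laguerreOne_coeff_of_lt hm, hg m hm]
    have hgh : g = h + c • laguerreOne n := by rw [hh]; ring
    have horth := laguerreIntegral_laguerreOne_mul_eq_zero hdeg
    have hI : laguerreIntegral (g * g) = laguerreIntegral (h * h) + c ^ 2 * (n + 1) := by
      have : g * g = h * h + (2 * c) • (laguerreOne n * h) +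
          c ^ 2 • (laguerreOne n * laguerreOne n) := by
        rw [hgh]; simp only [smul_eq_C_mul, C_mul, C_pow, C_ofNat]; ring
      rw [this, map_add, map_add, map_smul, map_smul, horth,
        laguerreIntegral_laguerreOne_mul_self]
      simp
    rw [hI, Finset.sum_range_succ, hgh, eval_add, eval_smul, smul_eq_mul]
    exact add_sq_le_of_sq_le_mul (by positivity) (laguerreIntegral_sq_nonneg h)
      (Finset.sum_nonneg fun k _ => by positivity) (ih h hdeg)

open Polynomial in
theorem abs_laguerreOne_eval_neg_le (k : ℕ) {t : ℝ} (ht : 0 ≤ t) :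
    |(laguerreOne k).eval (-t)| ≤ (k + 1) * Real.exp (k * t) := by
  rw [laguerreOne, eval_finsetSum]
  calc _ ≤ ∑ j ∈ Finset.range (k + 1), ((k : ℝ) + 1) * ((k * t) ^ j / j.factorial) := by
        refine (Finset.abs_sum_le_sum_abs _ _).trans (Finset.sum_le_sum fun j _ => ?_)
        have hchoose : (k + 1).choose (j + 1) ≤ (k + 1) * k ^ j :=
          calc (k + 1).choose (j + 1) ≤ (k + 1).choose (j + 1) * (j + 1) :=
                Nat.le_mul_of_pos_right _ j.succ_pos
            _ = (k + 1) * k.choose j := (Nat.add_one_mul_choose_eq k j).symm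
            _ ≤ _ := Nat.mul_le_mul_left _ (Nat.choose_le_pow _ _)
        have hchoose' : ((k + 1).choose (j + 1) : ℝ) ≤ (k + 1) * k ^ j := by exact_mod_cast hchoose
        simp only [eval_monomial, abs_mul, abs_div, abs_pow, abs_neg, abs_one, one_pow, one_mul,
          Nat.abs_cast, abs_of_nonneg ht]
        calc _ ≤ ((k : ℝ) + 1) * k ^ j / j.factorial * t ^ j := by gcongr
          _ = _ := by ring
    _ = (k + 1) * ∑ j ∈ Finset.range (k + 1), (k * t) ^ j / j.factorial := by
        rw [Finset.mul_sum]
    _ ≤ _ := by gcongr; exact Real.sum_le_exp_of_nonneg (by positivity) _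

open Polynomial in
theorem sum_laguerreOne_eval_neg_sq_le (d : ℕ) {t : ℝ} (ht : 0 ≤ t) :
    ∑ k ∈ Finset.range (d + 1), (laguerreOne k).eval (-t) ^ 2 / (k + 1) ≤
      ((d : ℝ) + 1) ^ 2 * Real.exp (2 * d * t) := by
  have hterm : ∀ k ∈ Finset.range (d + 1), (laguerreOne k).eval (-t) ^ 2 / (k + 1) ≤
      ((d : ℝ) + 1) * Real.exp (2 * d * t) := by
    intro k hk
    have hkd : (k : ℝ) ≤ d := by exact_mod_cast Nat.lt_succ_iff.mp (Finset.mem_range.mp hk)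
    rw [div_le_iff₀ (by positivity), ← sq_abs]
    calc |(laguerreOne k).eval (-t)| ^ 2 ≤ ((k + 1) * Real.exp (k * t)) ^ 2 := by
          gcongr; exact abs_laguerreOne_eval_neg_le k ht
      _ = (k + 1) * Real.exp (2 * k * t) * (k + 1) := by
          rw [mul_pow, ← Real.exp_nat_mul]; push_cast; ring_nf
      _ ≤ _ := by gcongr
  refine (Finset.sum_le_card_nsmul _ _ _ hterm).trans_eq ?_
  simp
  ring

theorem integral_ge_value_near_zero (d : ℕ) (Δ : ℝ) (hΔ : 0 < Δ)
    (hcond : 10 * ((d : ℝ) + 1) ^ 2 * Δ ^ 2 * Real.exp (2 * d * Δ) ≤ 1)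
    (g : Polynomial ℝ) (hg : g.natDegree ≤ d) :
    (∫ x in Set.Ioi (0 : ℝ), (g.eval x) ^ 2 * (x * Real.exp (-x))) ≥
      10 * Δ ^ 2 * (g.eval (-Δ)) ^ 2 := by
  have hI : (∫ x in Set.Ioi (0 : ℝ), (g.eval x) ^ 2 * (x * Real.exp (-x))) =
      laguerreIntegral (g * g) := by
    simp [laguerreIntegral, sq]
  have hdeg : g.degree < (d + 1 : ℕ) :=
    Polynomial.degree_le_natDegree.trans_lt (by exact_mod_cast Nat.lt_succ_of_le hg)
  have hpos := laguerreIntegral_sq_nonneg g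
  rw [hI, ge_iff_le]
  calc 10 * Δ ^ 2 * (g.eval (-Δ)) ^ 2
      ≤ 10 * Δ ^ 2 * (laguerreIntegral (g * g) *
          (((d : ℝ) + 1) ^ 2 * Real.exp (2 * d * Δ))) := by
        gcongr
        refine (eval_sq_le_laguerreIntegral_mul_sum (d + 1) (-Δ) g hdeg).trans ?_
        gcongr
        exact sum_laguerreOne_eval_neg_sq_le d hΔ.le
    _ = laguerreIntegral (g * g) *
          (10 * ((d : ℝ) + 1) ^ 2 * Δ ^ 2 * Real.exp (2 * d * Δ)) := by ring
    _ ≤ laguerreIntegral (g * g) := mul_le_of_le_one_right hpos hcond
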